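/- Let Φ be a reduced root system with positive roots Φ⁺, let n_Z = Σ_{α∈Φ⁺} Z X_α be the nilpotent part of a Chevalley order, and let R be a commutative ring in which 2 and 3 are invertible. For n_R = R ⊗_Z n_Z, the kernel of the bracket map ⋀² n_R → n_R equals the R-submodule generated by all decomposable x ∧ y with [x, y] = 0. -/

import Mathlib

open ExteriorAlgebra

/-- The wedge `x ∧ y` as an element of the exterior square `⋀[R]^2 M`. -/
noncomputable def wedge2 (R : Type*) {M : Type*} [CommRing R] [AddCommGroup M] [Module R M]
    (x y : M) : ⋀[R]^2 M :=
  ⟨ExteriorAlgebra.ιMulti R 2 ![x, y],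
    ExteriorAlgebra.ιMulti_range R 2 (Set.mem_range_self _)⟩

/-- The submodule `⋀L ⊆ ⋀²L` generated by the decomposable elements `x∧y` with `⁅x,y⁆ = 0`. -/
noncomputable def wedgeDecomp (R L : Type*) [CommRing R] [LieRing L] [LieAlgebra R L] :
    Submodule R (⋀[R]^2 L) :=
  Submodule.span R {w | ∃ x y : L, ⁅x, y⁆ = 0 ∧ w = wedge2 R x y}

/-- A reduced root system in a real vector space `V`, given with a choice of coroots:
`coroot α` is the linear form `⟨·, α^∨⟩`. -/
structure RootSystemData (V : Type*) [AddCommGroup V] [Module ℝ V] where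
  /-- the set of roots -/
  Φ : Set V
  finite : Φ.Finite
  span_eq : Submodule.span ℝ Φ = ⊤
  zero_not_mem : (0 : V) ∉ Φ
  neg_mem : ∀ α ∈ Φ, -α ∈ Φ
  reduced : ∀ α ∈ Φ, ∀ c : ℝ, c • α ∈ Φ → c = 1 ∨ c = -1
  /-- the coroot `α^∨`, viewed as the linear form `⟨·, α^∨⟩` on `V` -/
  coroot : V → (V →ₗ[ℝ] ℝ)
  coroot_self : ∀ α ∈ Φ, coroot α α = 2
  reflect_mem : ∀ α ∈ Φ, ∀ β ∈ Φ, β - coroot α β • α ∈ Φ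
  integral : ∀ α ∈ Φ, ∀ β ∈ Φ, ∃ n : ℤ, coroot α β = (n : ℝ)

/-- The base change `g_R = R ⊗_ℤ g_ℤ` of a Chevalley order
`g_ℤ = h_ℤ + ∑_{α∈Φ} ℤ X_α` of a split reductive Lie algebra, together with its Chevalley
system `(X_α)`, coroots `H_α`, Cartan part `h_R` and the roots `α` viewed as `R`-linear forms
on `g_R` (restricting to the usual forms on `h_R`). -/
structure ChevalleyOrderR (R : Type*) (V : Type*) (L : Type*) [CommRing R]
    [AddCommGroup V] [Module ℝ V] [LieRing L] [LieAlgebra R L] where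
  /-- the underlying (reduced) root system -/
  rs : RootSystemData V
  /-- the Cartan part `h_R = R ⊗ h_ℤ` -/
  hR : Submodule R L
  /-- the Chevalley system `X_α` (for `α ∈ Φ`) -/
  X : V → L
  /-- the coroots `H_α` (for `α ∈ Φ`) -/
  H : V → L
  /-- the root `α` as an `R`-linear form -/
  form : V → (L →ₗ[R] R)
  /-- the structure constants `N_{αβ}` -/
  N : V → V → R
  H_mem : ∀ α ∈ rs.Φ, H α ∈ hR
  H_neg : ∀ α ∈ rs.Φ, H (-α) = -H α
  form_H_self : ∀ α ∈ rs.Φ, form α (H α) = 2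
  form_H_int : ∀ α ∈ rs.Φ, ∀ β ∈ rs.Φ, ∃ n : ℤ,
    form α (H β) = (n : R) ∧ (n : ℝ) = rs.coroot β α
  lie_hh : ∀ h ∈ hR, ∀ h' ∈ hR, ⁅h, h'⁆ = 0
  lie_hX : ∀ α ∈ rs.Φ, ∀ h ∈ hR, ⁅h, X α⁆ = form α h • X α
  lie_XnegX : ∀ α ∈ rs.Φ, ⁅X α, X (-α)⁆ = -H α
  lie_XX : ∀ α ∈ rs.Φ, ∀ β ∈ rs.Φ, α + β ∈ rs.Φ → ⁅X α, X β⁆ = N α β • X (α + β)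
  lie_XX_zero : ∀ α ∈ rs.Φ, ∀ β ∈ rs.Φ, α + β ∉ rs.Φ → α + β ≠ 0 → ⁅X α, X β⁆ = 0
  N_unit : ∀ α ∈ rs.Φ, ∀ β ∈ rs.Φ, α + β ∈ rs.Φ → IsUnit (N α β)
  N_neg : ∀ α ∈ rs.Φ, ∀ β ∈ rs.Φ, α + β ∈ rs.Φ → N (-α) (-β) = N α β
  X_indep : LinearIndependent R (fun a : rs.Φ => X a)
  sup_eq : hR ⊔ Submodule.span R (X '' rs.Φ) = ⊤
  inf_eq : hR ⊓ Submodule.span R (X '' rs.Φ) = ⊥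

namespace RootSystemData

variable {V : Type*} [AddCommGroup V] [Module ℝ V] (rs : RootSystemData V)

lemma coroot_injOn : Set.InjOn rs.coroot rs.Φ := by
  intro α hα β hβ h
  by_contra hne
  have hβα : rs.coroot β α = 2 := h ▸ rs.coroot_self α hα
  have hαβ : rs.coroot α β = 2 := h ▸ rs.coroot_self β hβ
  have hmem : ∀ k : ℕ, α + (2 * k : ℝ) • (α - β) ∈ rs.Φ := by
    intro k
    induction k with
    | zero => simpa using hα
    | succ k ih =>
      have h₁ := rs.reflect_mem α hα _ (rs.reflect_mem β hβ _ ih)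
      simp only [map_add, map_sub, map_smul, smul_eq_mul, hβα, hαβ, rs.coroot_self α hα,
        rs.coroot_self β hβ] at h₁
      convert h₁ using 1
      push_cast
      module
  refine Set.infinite_of_injective_forall_mem (f := fun k : ℕ ↦ α + (2 * k : ℝ) • (α - β))
    ?_ hmem rs.finite
  intro k l hkl
  have := smul_left_injective ℝ (sub_ne_zero.mpr hne) (add_left_cancel hkl)
  simpa using this

lemma finiteDimensional {V : Type*} [AddCommGroup V] [Module ℝ V] (rs : RootSystemData V) :
    FiniteDimensional ℝ V :=
  Module.finite_def.mpr ⟨rs.finite.toFinset, by simpa using rs.span_eq⟩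

/-- A symmetric bilinear form on `V`, positive on the roots, such that for roots `u`, `v` the numbers
`2 B(u, v) / B(v, v)` and `2 B(u, v) / B(u, u)` are the Cartan integers of a reduced root system. -/
structure IsRootForm (B : LinearMap.BilinForm ℝ V) : Prop where
  symm : ∀ u v, B u v = B v u
  pos : ∀ u ∈ rs.Φ, 0 < B u u
  cartan : ∀ u ∈ rs.Φ, ∀ v ∈ rs.Φ, ∃ m n : ℤ,
    2 * B u v = m * B v v ∧ 2 * B u v = n * B u u ∧
    (m, n) ∈ ({(0, 0), (1, 1), (-1, -1), (1, 2), (2, 1), (-1, -2), (-2, -1), (1, 3), (3, 1),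
      (-1, -3), (-3, -1), (2, 2), (-2, -2)} : Set (ℤ × ℤ))

lemma exists_isRootForm : ∃ B : LinearMap.BilinForm ℝ V, rs.IsRootForm B := by
  have := rs.finiteDimensional
  have : Finite rs.Φ := rs.finite
  have : Fintype rs.Φ := Fintype.ofFinite _
  let P : RootPairing rs.Φ ℝ V (Module.Dual ℝ V) :=
    RootPairing.mk'' (Module.Dual.eval ℝ V) (Function.Embedding.subtype _)
      ⟨fun a ↦ rs.coroot a, fun a b h ↦ Subtype.ext (rs.coroot_injOn a.2 b.2 h)⟩
      (fun a ↦ rs.coroot_self a a.2)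
      (by
        rintro a - ⟨c, rfl⟩
        exact ⟨⟨_, rs.reflect_mem a a.2 c c.2⟩, rfl⟩)
      (by simpa using rs.span_eq)
  have hP : ∀ a, P.root a = a := fun _ ↦ rfl
  have : P.IsCrystallographic := ⟨fun a c ↦ by
    obtain ⟨n, hn⟩ := rs.integral c c.2 a a.2
    exact ⟨n, hn.symm⟩⟩
  have : P.IsReduced := ⟨fun a c hli ↦ by
    rw [hP, hP] at *
    rw [LinearIndependent.pair_iff' (fun h ↦ rs.zero_not_mem (h ▸ a.2))] at hli
    push Not at hli
    obtain ⟨t, ht⟩ := hli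
    rcases rs.reduced a a.2 t (ht ▸ c.2) with rfl | rfl
    · simp [← ht]
    · simp [← ht]⟩
  refine ⟨P.RootForm, fun u v ↦ (P.rootForm_symmetric.eq v u).symm, fun u hu ↦ ?_,
    fun u hu v hv ↦ ?_⟩
  · obtain ⟨s, hs, hs'⟩ := (P.posRootForm ℝ).exists_pos_eq ⟨u, hu⟩
    have : s = P.RootForm u u := hs'
    exact this ▸ hs
  · refine ⟨P.pairingIn ℤ ⟨u, hu⟩ ⟨v, hv⟩, P.pairingIn ℤ ⟨v, hv⟩ ⟨u, hu⟩, ?_, ?_,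
      P.pairingIn_pairingIn_mem_set_of_isCrystal_of_isRed ⟨u, hu⟩ ⟨v, hv⟩⟩
    · have := (P.posRootForm ℤ).two_mul_apply_root_root ⟨u, hu⟩ ⟨v, hv⟩
      rw [← P.algebraMap_pairingIn ℤ] at this
      exact this
    · have := (P.posRootForm ℤ).two_mul_apply_root_root ⟨v, hv⟩ ⟨u, hu⟩
      rw [← P.algebraMap_pairingIn ℤ, ← (P.posRootForm ℤ).symm.eq] at this
      exact this

namespace IsRootForm

variable {rs} {B : LinearMap.BilinForm ℝ V}

/-- The possible angles and length ratios of two roots whose sum is a root. -/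
lemma trichotomy_of_add_mem (hB : rs.IsRootForm B) {u v : V} (hu : u ∈ rs.Φ) (hv : v ∈ rs.Φ)
    (huv : u + v ∈ rs.Φ) :
    B u v < 0 ∨ (B u v = 0 ∧ B u u = B v v) ∨ (2 * B u v = B u u ∧ B u u = B v v) := by
  have hsymm := hB.symm v u
  have h₁ := hB.pos u hu
  have h₂ := hB.pos v hv
  have h₃ := hB.pos _ huv
  obtain ⟨m, n, hm, hn, hmn⟩ := hB.cartan _ huv _ hu
  obtain ⟨m', n', hm', hn', hmn'⟩ := hB.cartan _ huv _ hv
  simp only [map_add, LinearMap.add_apply, hsymm] at *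
  simp only [Set.mem_insert_iff, Set.mem_singleton_iff, Prod.mk.injEq] at hmn hmn'
  rcases lt_or_ge (B u v) 0 with h | h
  · exact .inl h
  right
  rcases hmn with h | h | h | h | h | h | h | h | h | h | h | h | h <;>
    obtain ⟨rfl, rfl⟩ := h <;> push_cast at hm hn <;> try (exfalso; linarith)
  all_goals
    rcases hmn' with h | h | h | h | h | h | h | h | h | h | h | h | h <;>
      obtain ⟨rfl, rfl⟩ := h <;> push_cast at hm' hn' <;> try (exfalso; linarith)
  all_goals first | (left; constructor <;> linarith) | (right; constructor <;> linarith)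

set_option maxHeartbeats 2000000 in
/-- The case of roots `a`, `x` of equal length spanning a `60` degree angle, so that `a`, `x` span a
root system of type `G₂`. -/
lemma false_of_two_mul_eq (hB : rs.IsRootForm B) {a x y : V} (ha : a ∈ rs.Φ)
    (hx : x ∈ rs.Φ) (hy : y ∈ rs.Φ) (hax : a + x ∈ rs.Φ) (hay : a + y ∈ rs.Φ)
    (hxy : x + y ∈ rs.Φ) (hxya : x + y - a ∈ rs.Φ)
    (h : 2 * B a x = B a a) (h' : B a a = B x x) : False := by
  have s₁ := hB.symm x a
  have s₂ := hB.symm y a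
  have s₃ := hB.symm y x
  have p₁ := hB.pos a ha
  have p₂ := hB.pos y hy
  have p₃ := hB.pos _ hay
  have p₄ := hB.pos _ hxy
  have p₅ := hB.pos _ hxya
  have t₁ := hB.trichotomy_of_add_mem ha hy hay
  have t₂ := hB.trichotomy_of_add_mem hx hy hxy
  obtain ⟨m₁, n₁, hm₁, hn₁, h₁⟩ := hB.cartan _ ha _ hy
  obtain ⟨m₂, n₂, hm₂, hn₂, h₂⟩ := hB.cartan _ hx _ hy
  obtain ⟨m₃, n₃, hm₃, hn₃, h₃⟩ := hB.cartan _ hax _ hy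
  obtain ⟨m₄, n₄, hm₄, hn₄, h₄⟩ := hB.cartan _ hxya _ ha
  simp only [map_add, map_sub, LinearMap.add_apply, LinearMap.sub_apply, s₁, s₂, s₃] at *
  simp only [Set.mem_insert_iff, Set.mem_singleton_iff, Prod.mk.injEq] at h₁ h₂ h₃ h₄
  rcases h₁ with h | h | h | h | h | h | h | h | h | h | h | h | h <;>
    obtain ⟨rfl, rfl⟩ := h <;> push_cast at hm₁ hn₁ <;>
    rcases t₁ with t | ⟨t, t'⟩ | ⟨t, t'⟩ <;> try linarith
  all_goals
    rcases h₂ with h | h | h | h | h | h | h | h | h | h | h | h | h <;>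
      obtain ⟨rfl, rfl⟩ := h <;> push_cast at hm₂ hn₂ <;>
      rcases t₂ with t₂ | ⟨t₂, t₂'⟩ | ⟨t₂, t₂'⟩ <;> try linarith
  all_goals
    rcases h₃ with h | h | h | h | h | h | h | h | h | h | h | h | h <;>
      obtain ⟨rfl, rfl⟩ := h <;> push_cast at hm₃ hn₃ <;> try linarith
  all_goals
    rcases h₄ with h | h | h | h | h | h | h | h | h | h | h | h | h <;>
      obtain ⟨rfl, rfl⟩ := h <;> push_cast at hm₄ hn₄ <;> linarith

set_option maxHeartbeats 1000000 in
/-- No roots `a`, `x`, `y` have all of `a + x`, `a + y`, `x + y` and `x + y - a` as roots. -/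
lemma false_of_add_mem (hB : rs.IsRootForm B) {a x y : V} (ha : a ∈ rs.Φ)
    (hx : x ∈ rs.Φ) (hy : y ∈ rs.Φ) (hax : a + x ∈ rs.Φ) (hay : a + y ∈ rs.Φ)
    (hxy : x + y ∈ rs.Φ) (hxya : x + y - a ∈ rs.Φ) :
    False := by
  have s₁ := hB.symm x a
  have s₂ := hB.symm y a
  have s₃ := hB.symm y x
  have p₁ := hB.pos a ha
  have p₂ := hB.pos x hx
  have p₃ := hB.pos y hy
  have p₄ := hB.pos _ hxy
  have t₁ := hB.trichotomy_of_add_mem ha hx hax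
  have t₂ := hB.trichotomy_of_add_mem ha hy hay
  have t₃ := hB.trichotomy_of_add_mem hxy (rs.neg_mem a ha) (by rwa [← sub_eq_add_neg])
  rw [← or_assoc] at t₁ t₂
  replace t₁ := t₁.resolve_right fun h ↦ hB.false_of_two_mul_eq ha hx hy hax hay hxy hxya h.1 h.2
  replace t₂ := t₂.resolve_right fun h ↦ hB.false_of_two_mul_eq ha hy hx hay hax
    (by rwa [add_comm]) (by rwa [add_comm y]) h.1 h.2
  obtain ⟨m₁, n₁, hm₁, hn₁, h₁⟩ := hB.cartan _ ha _ hx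
  obtain ⟨m₂, n₂, hm₂, hn₂, h₂⟩ := hB.cartan _ ha _ hy
  obtain ⟨m₃, n₃, hm₃, hn₃, h₃⟩ := hB.cartan _ hax _ hxya
  simp only [map_add, map_sub, map_neg, LinearMap.add_apply, LinearMap.sub_apply,
    LinearMap.neg_apply, s₁, s₂, s₃] at *
  simp only [Set.mem_insert_iff, Set.mem_singleton_iff, Prod.mk.injEq] at h₁ h₂ h₃
  rcases t₁ with t₁ | ⟨t₁, t₁'⟩ <;> rcases t₂ with t₂ | ⟨t₂, t₂'⟩ <;>
    rcases t₃ with t₃ | ⟨t₃, t₃'⟩ | ⟨t₃, t₃'⟩ <;> try linarith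
  all_goals
    rcases h₁ with h | h | h | h | h | h | h | h | h | h | h | h | h <;>
      obtain ⟨rfl, rfl⟩ := h <;> push_cast at hm₁ hn₁ <;> try linarith
  all_goals
    rcases h₂ with h | h | h | h | h | h | h | h | h | h | h | h | h <;>
      obtain ⟨rfl, rfl⟩ := h <;> push_cast at hm₂ hn₂ <;> try linarith
  all_goals
    rcases h₃ with h | h | h | h | h | h | h | h | h | h | h | h | h <;>
      obtain ⟨rfl, rfl⟩ := h <;> push_cast at hm₃ hn₃ <;> linarith

end IsRootForm

/-- Given two decompositions of a root as a sum of two roots, one of the two ways of matching them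
up has no sum of matched roots which is a root. -/
lemma add_notMem_or_add_notMem {α β α' β' : V} (hα : α ∈ rs.Φ) (hβ : β ∈ rs.Φ) (hα' : α' ∈ rs.Φ)
    (hβ' : β' ∈ rs.Φ) (hαβ : α + β ∈ rs.Φ) (h : α + β = α' + β') :
    (α + β' ∉ rs.Φ ∧ α' + β ∉ rs.Φ) ∨ (α + α' ∉ rs.Φ ∧ β' + β ∉ rs.Φ) := by
  obtain ⟨B, hB⟩ := rs.exists_isRootForm
  have key {a b x y : V} (ha : a ∈ rs.Φ) (hb : b ∈ rs.Φ) (hx : x ∈ rs.Φ) (hy : y ∈ rs.Φ)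
      (hab : a + b ∈ rs.Φ) (h : a + b = x + y) (hax : a + x ∈ rs.Φ) (hay : a + y ∈ rs.Φ) : False :=
    hB.false_of_add_mem ha hx hy hax hay (h ▸ hab) (by rwa [← h, add_sub_cancel_left])
  by_contra! hcon
  obtain ⟨h₁, h₂⟩ := hcon
  by_cases h₃ : α + β' ∈ rs.Φ <;> by_cases h₄ : α + α' ∈ rs.Φ
  · exact key hα hβ hα' hβ' hαβ h h₄ h₃
  · exact key hβ' hα' hβ hα (by rwa [add_comm, ← h]) (by rw [add_comm, ← h, add_comm])
      (h₂ h₄) (by rwa [add_comm])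
  · exact key hα' hβ' hα hβ (by rwa [← h]) h.symm (by rwa [add_comm]) (h₁ h₃)
  · exact key hβ hα hα' hβ' (by rwa [add_comm]) (by rw [add_comm, h])
      (by rw [add_comm]; exact h₁ h₃) (by rw [add_comm]; exact h₂ h₄)

end RootSystemData

section Wedge

variable {R M : Type*} [CommRing R] [AddCommGroup M] [Module R M]

lemma coe_wedge2 (x y : M) : (wedge2 R x y : ExteriorAlgebra R M) = ι R x * ι R y := by
  simp [wedge2, ιMulti_apply]

lemma wedge2_add_left (x x' y : M) : wedge2 R (x + x') y = wedge2 R x y + wedge2 R x' y :=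
  Subtype.ext <| by simp [coe_wedge2, add_mul]

lemma wedge2_sub_right (x y y' : M) : wedge2 R x (y - y') = wedge2 R x y - wedge2 R x y' :=
  Subtype.ext <| by simp [coe_wedge2, mul_sub]

lemma wedge2_smul_right (r : R) (x y : M) : wedge2 R x (r • y) = r • wedge2 R x y :=
  Subtype.ext <| by simp [coe_wedge2]

lemma wedge2_swap (x y : M) : wedge2 R y x = -wedge2 R x y :=
  Subtype.ext <| by
    simpa [coe_wedge2] using eq_neg_of_add_eq_zero_left (ι_add_mul_swap (R := R) y x)

lemma span_wedge2_eq_top {s : Set M} (hs : Submodule.span R s = ⊤) :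
    Submodule.span R {w | ∃ x ∈ s, ∃ y ∈ s, w = wedge2 R x y} = ⊤ := by
  rw [eq_top_iff, ← exteriorPower.ιMulti_span_of_span R 2 M hs]
  refine Submodule.span_mono ?_
  rintro - ⟨a, ha, rfl⟩
  refine ⟨a 0, ha ⟨0, rfl⟩, a 1, ha ⟨1, rfl⟩, Subtype.ext ?_⟩
  simp [coe_wedge2, ιMulti_apply, Matrix.vecTail]

end Wedge

section WedgeDecomp

variable {R L : Type*} [CommRing R] [LieRing L] [LieAlgebra R L]

lemma wedge2_mem_wedgeDecomp {x y : L} (h : ⁅x, y⁆ = 0) : wedge2 R x y ∈ wedgeDecomp R L :=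
  Submodule.subset_span ⟨x, y, h, rfl⟩

lemma smul_wedge2_sub_mem_wedgeDecomp {x y x' y' z : L} {m n : R} (h : ⁅x, y⁆ = m • z)
    (h' : ⁅x', y'⁆ = n • z) (hxy' : ⁅x, y'⁆ = 0) (hx'y : ⁅x', y⁆ = 0) :
    n • wedge2 R x y - m • wedge2 R x' y' ∈ wedgeDecomp R L := by
  have key : wedge2 R (x + x') (n • y - m • y') ∈ wedgeDecomp R L := by
    refine wedge2_mem_wedgeDecomp ?_
    simp only [add_lie, lie_sub, lie_smul, h, h', hxy', hx'y]
    module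
  have := sub_mem (add_mem key (Submodule.smul_mem _ m (wedge2_mem_wedgeDecomp hxy')))
    (Submodule.smul_mem _ n (wedge2_mem_wedgeDecomp hx'y))
  convert this using 1
  simp only [wedge2_add_left, wedge2_sub_right, wedge2_smul_right]
  module

end WedgeDecomp

/-- Let Φ be a reduced root system with positive roots Φ⁺, let n_ℤ = ∑_{α∈Φ⁺} ℤ X_α be the
nilpotent part of a Chevalley order, and let R be a commutative ring in which 2 and 3 are
invertible.  For n_R = R ⊗_ℤ n_ℤ, the kernel of the bracket map ⋀² n_R → n_R equals the
R-submodule generated by all decomposable x ∧ y with ⁅x, y⁆ = 0. -/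
theorem stmt11 (R V L : Type*) [CommRing R] [AddCommGroup V] [Module ℝ V]
    [LieRing L] [LieAlgebra R L]
    (h2 : IsUnit (2 : R)) (h3 : IsUnit (3 : R))
    (rs : RootSystemData V)
    (Pos : Set V) (hPos_sub : Pos ⊆ rs.Φ)
    (hPos_tot : ∀ α ∈ rs.Φ, α ∈ Pos ∨ -α ∈ Pos)
    (hPos_disj : ∀ α ∈ Pos, -α ∉ Pos)
    (hPos_closed : ∀ α ∈ Pos, ∀ β ∈ Pos, α + β ∈ rs.Φ → α + β ∈ Pos)
    (X : V → L) (N : V → V → R)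
    (hXX : ∀ α ∈ Pos, ∀ β ∈ Pos, α + β ∈ rs.Φ → ⁅X α, X β⁆ = N α β • X (α + β))
    (hXX_zero : ∀ α ∈ Pos, ∀ β ∈ Pos, α + β ∉ rs.Φ → ⁅X α, X β⁆ = 0)
    (hN_unit : ∀ α ∈ Pos, ∀ β ∈ Pos, α + β ∈ rs.Φ → IsUnit (N α β))
    (hindep : LinearIndependent R (fun a : Pos => X a))
    (hspan : Submodule.span R (X '' Pos) = ⊤)
    (b : (⋀[R]^2 L) →ₗ[R] L) (hb : ∀ x y : L, b (wedge2 R x y) = ⁅x, y⁆) :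
    LinearMap.ker b = wedgeDecomp R L := by
  have exchange {α β α' β' : V} (hα : α ∈ Pos) (hβ : β ∈ Pos) (hα' : α' ∈ Pos) (hβ' : β' ∈ Pos)
      (hαβ : α + β ∈ rs.Φ) (h : α' + β' = α + β) :
      N α' β' • wedge2 R (X α) (X β) - N α β • wedge2 R (X α') (X β') ∈ wedgeDecomp R L := by
    have h₁ := hXX α hα β hβ hαβ
    have h₂ := hXX α' hα' β' hβ' (h ▸ hαβ)
    rw [h] at h₂
    rcases rs.add_notMem_or_add_notMem (hPos_sub hα) (hPos_sub hβ) (hPos_sub hα') (hPos_sub hβ')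
      hαβ h.symm with ⟨h₃, h₄⟩ | ⟨h₃, h₄⟩
    · exact smul_wedge2_sub_mem_wedgeDecomp h₁ h₂ (hXX_zero α hα β' hβ' h₃)
        (hXX_zero α' hα' β hβ h₄)
    · have h₅ : ⁅X β', X α'⁆ = (-N α' β') • X (α + β) := by rw [← lie_skew, h₂, neg_smul]
      have := neg_mem (smul_wedge2_sub_mem_wedgeDecomp h₁ h₅ (hXX_zero α hα α' hα' h₃)
        (hXX_zero β' hβ' β hβ h₄))
      convert this using 1
      rw [wedge2_swap (X α') (X β')]
      module
  apply le_antisymm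
  · classical
    have hsplit (γ : Pos) : ∃ q : (⋀[R]^2 L) ⧸ wedgeDecomp R L, ∀ α ∈ Pos, ∀ β ∈ Pos,
        α + β = γ → N α β • q = (wedgeDecomp R L).mkQ (wedge2 R (X α) (X β)) := by
      by_cases hγ : ∃ α ∈ Pos, ∃ β ∈ Pos, α + β = γ
      · obtain ⟨α', hα', β', hβ', h'⟩ := hγ
        obtain ⟨u, hu⟩ := hN_unit α' hα' β' hβ' (h' ▸ hPos_sub γ.2)
        refine ⟨(↑u⁻¹ : R) • (wedgeDecomp R L).mkQ (wedge2 R (X α') (X β')),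
          fun α hα β hβ h ↦ ?_⟩
        have hex := exchange hα hβ hα' hβ' (h ▸ hPos_sub γ.2) (h'.trans h.symm)
        rw [← (wedgeDecomp R L).ker_mkQ, LinearMap.mem_ker, map_sub, map_smul, map_smul,
          sub_eq_zero, ← hu] at hex
        rw [smul_comm, ← hex, smul_smul, Units.inv_mul, one_smul]
      · exact ⟨0, fun α hα β hβ h ↦ absurd ⟨α, hα, β, hβ, h⟩ hγ⟩
    choose q hq using hsplit
    let e : Module.Basis Pos R L := Module.Basis.mk hindep (by rw [← hspan, Set.image_eq_range])
    have he (γ : V) (hγ : γ ∈ Pos) : e.constr R q (X γ) = q ⟨γ, hγ⟩ := by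
      have : X γ = e ⟨γ, hγ⟩ := by simp [e]
      rw [this, Module.Basis.constr_basis]
    have hmk : e.constr R q ∘ₗ b = (wedgeDecomp R L).mkQ := by
      refine LinearMap.ext_on (span_wedge2_eq_top hspan) ?_
      rintro - ⟨-, ⟨α, hα, rfl⟩, -, ⟨β, hβ, rfl⟩, rfl⟩
      rw [LinearMap.comp_apply, hb]
      by_cases h : α + β ∈ rs.Φ
      · rw [hXX α hα β hβ h, map_smul, he _ (hPos_closed α hα β hβ h), hq _ α hα β hβ rfl]
      · have h₀ := hXX_zero α hα β hβ h
        rw [h₀, map_zero, eq_comm, ← LinearMap.mem_ker, Submodule.ker_mkQ]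
        exact wedge2_mem_wedgeDecomp h₀
    rw [← (wedgeDecomp R L).ker_mkQ, ← hmk]
    exact LinearMap.ker_le_ker_comp _ _
  · refine Submodule.span_le.mpr ?_
    rintro - ⟨x, y, hxy, rfl⟩
    exact (hb x y).trans hxy
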